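/- Core optimization lemma for the optimal hash count: the function p ↦ (ln p)·(ln(1−p)) on the open interval (0,1) attains its maximum value (ln 2)² at p = 1/2, and this maximizer is unique: for every p ∈ (0,1) with p ≠ 1/2, one has (ln p)·(ln(1−p)) < (ln 2)². -/

import Mathlib

/-- For `0 < p < 1/2`, strict concavity of `log` gives `p * log p < (1 - p) * log (1 - p)`. -/
lemma mul_log_lt_one_sub_mul_log_one_sub {p : ℝ} (hp : 0 < p) (hp' : p < 1 / 2) :
    p * Real.log p < (1 - p) * Real.log (1 - p) := by
  have h := strictConcaveOn_log_Ioi.slope_anti_adjacent (x := p) (y := 1 - p) (z := 1)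
    hp (Set.mem_Ioi.2 one_pos) (by linarith) (by linarith)
  rw [div_lt_div_iff₀ (by linarith) (by linarith), Real.log_one] at h
  linarith

lemma strictMonoOn_log_mul_log_one_sub :
    StrictMonoOn (fun p : ℝ ↦ Real.log p * Real.log (1 - p)) (Set.Ioc 0 (1 / 2)) := by
  have hderiv (p : ℝ) (h0 : 0 < p) (h1 : p < 1) :
      HasDerivAt (fun p : ℝ ↦ Real.log p * Real.log (1 - p))
        (p⁻¹ * Real.log (1 - p) + Real.log p * (-1 / (1 - p))) p :=
    (Real.hasDerivAt_log h0.ne').mul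
      (((hasDerivAt_id p).const_sub 1).log (sub_pos.2 h1).ne')
  refine strictMonoOn_of_deriv_pos (convex_Ioc _ _) (fun p hp ↦ ?_) fun p hp ↦ ?_
  · exact (hderiv p hp.1 (by linarith [hp.2])).continuousAt.continuousWithinAt
  · rw [interior_Ioc] at hp
    have h0 : 0 < p := hp.1
    have h1 : 0 < 1 - p := by linarith [hp.2]
    rw [(hderiv p h0 (by linarith)).deriv]
    have key := mul_log_lt_one_sub_mul_log_one_sub h0 hp.2
    have heq : p⁻¹ * Real.log (1 - p) + Real.log p * (-1 / (1 - p)) =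
        ((1 - p) * Real.log (1 - p) - p * Real.log p) / (p * (1 - p)) := by
      field_simp
      ring
    rw [heq]
    exact div_pos (sub_pos.2 key) (mul_pos h0 h1)

/-- **Core optimization lemma for the optimal hash count.** The function
`p ↦ (log p) * (log (1 - p))` on `(0, 1)` attains its maximum value `(log 2)²` at
`p = 1/2`, and the maximizer is unique: for every `p ∈ (0, 1)` with `p ≠ 1/2`,
`(log p) * (log (1 - p)) < (log 2)²`. -/
theorem log_mul_log_one_sub_max
    : Real.log (1 / 2) * Real.log (1 - 1 / 2) = (Real.log 2) ^ 2 ∧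
      ∀ p ∈ Set.Ioo (0 : ℝ) 1,
        Real.log p * Real.log (1 - p) ≤ (Real.log 2) ^ 2 ∧
        (p ≠ 1 / 2 → Real.log p * Real.log (1 - p) < (Real.log 2) ^ 2) := by
  have hhalf : Real.log (1 / 2) * Real.log (1 - 1 / 2) = (Real.log 2) ^ 2 := by
    rw [show (1 : ℝ) - 1 / 2 = 1 / 2 by norm_num, one_div, Real.log_inv]
    ring
  have hlt {p : ℝ} (h0 : 0 < p) (h1 : p < 1 / 2) :
      Real.log p * Real.log (1 - p) < (Real.log 2) ^ 2 :=
    hhalf ▸ strictMonoOn_log_mul_log_one_sub ⟨h0, h1.le⟩ ⟨by norm_num, le_rfl⟩ h1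
  have hne (p : ℝ) (hp : p ∈ Set.Ioo (0 : ℝ) 1) (h : p ≠ 1 / 2) :
      Real.log p * Real.log (1 - p) < (Real.log 2) ^ 2 := by
    rcases lt_or_gt_of_ne h with h | h
    · exact hlt hp.1 h
    · have := hlt (p := 1 - p) (by linarith [hp.2]) (by linarith)
      rwa [sub_sub_cancel, mul_comm] at this
  refine ⟨hhalf, fun p hp ↦ ⟨?_, hne p hp⟩⟩
  rcases eq_or_ne p (1 / 2) with rfl | h
  · exact hhalf.le
  · exact (hne p hp h).le
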